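/- Every non-trivial finitely generated bi-orderable group admits a non-trivial group homomorphism to the additive group ℝ. -/

import Mathlib

/-- A group is bi-orderable if it admits a linear order invariant under both left and right
multiplication. -/
def BiOrderable (G : Type*) [Group G] : Prop :=
  ∃ lo : LinearOrder G, ∀ g a b : G, lo.le a b → lo.le (g * a) (g * b) ∧ lo.le (a * g) (b * g)

open Filter Topology

section PreorderedMonoid

variable {M : Type*} [Monoid M] [Preorder M] [MulLeftMono M] [MulRightMono M] {a b : M}

theorem mul_pow_le_pow_mul_of_mul_le_mul (h : a * b ≤ b * a) (k : ℕ) :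
    a * b ^ k ≤ b ^ k * a := by
  induction k with
  | zero => simp
  | succ k ih =>
    calc a * b ^ (k + 1) = a * b ^ k * b := by rw [pow_succ, mul_assoc]
      _ ≤ b ^ k * a * b := by gcongr
      _ = b ^ k * (a * b) := mul_assoc ..
      _ ≤ b ^ k * (b * a) := by gcongr
      _ = b ^ (k + 1) * a := by rw [pow_succ, mul_assoc]

theorem pow_mul_le_mul_pow_of_mul_le_mul (h : a * b ≤ b * a) (k : ℕ) :
    a ^ k * b ≤ b * a ^ k :=
  mul_pow_le_pow_mul_of_mul_le_mul (M := Mᵒᵈ) (a := b) (b := a) h k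

theorem pow_mul_pow_le_mul_pow_of_mul_le_mul (h : a * b ≤ b * a) (k : ℕ) :
    a ^ k * b ^ k ≤ (a * b) ^ k := by
  induction k with
  | zero => simp
  | succ k ih =>
    calc a ^ (k + 1) * b ^ (k + 1) = a ^ k * (a * b ^ k) * b := by
          simp only [pow_succ, mul_assoc]
      _ ≤ a ^ k * (b ^ k * a) * b := by
          exact mul_le_mul_left (mul_le_mul_right (mul_pow_le_pow_mul_of_mul_le_mul h k) _) _
      _ = a ^ k * b ^ k * (a * b) := by simp only [mul_assoc]
      _ ≤ (a * b) ^ k * (a * b) := by gcongr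
      _ = (a * b) ^ (k + 1) := (pow_succ ..).symm

theorem mul_pow_le_pow_mul_pow_of_mul_le_mul (h : a * b ≤ b * a) (k : ℕ) :
    (a * b) ^ k ≤ b ^ k * a ^ k := by
  induction k with
  | zero => simp
  | succ k ih =>
    calc (a * b) ^ (k + 1) = (a * b) ^ k * (a * b) := pow_succ ..
      _ ≤ b ^ k * a ^ k * (a * b) := by gcongr
      _ = b ^ k * (a ^ (k + 1) * b) := by simp only [pow_succ, mul_assoc]
      _ ≤ b ^ k * (b * a ^ (k + 1)) := by
          exact mul_le_mul_right (pow_mul_le_mul_pow_of_mul_le_mul h (k + 1)) _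
      _ = b ^ (k + 1) * a ^ (k + 1) := by simp only [pow_succ, mul_assoc]

end PreorderedMonoid

theorem zpow_strictMono_of_one_lt {G : Type*} [Group G] [Preorder G]
    [MulLeftStrictMono G] {x : G} (hx : 1 < x) : StrictMono fun n : ℤ => x ^ n :=
  strictMono_int_of_lt_succ fun n => by
    rw [zpow_add_one]
    exact lt_mul_of_one_lt_right' _ hx

section OrderedGroup

variable {G : Type*} [Group G] [LinearOrder G] [MulLeftMono G] [MulRightMono G]

/-- In a finitely generated ordered group, the powers of a suitable element are cofinal. -/
theorem exists_one_lt_forall_exists_le_pow [Group.FG G] [Nontrivial G] :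
    ∃ x : G, 1 < x ∧ ∀ g : G, ∃ n : ℕ, g ≤ x ^ n := by
  classical
  obtain ⟨S, hS⟩ := Group.fg_def.1 (inferInstance : Group.FG G)
  obtain ⟨y, hy⟩ := exists_ne (1 : G)
  have hne : (insert y S).Nonempty := Finset.insert_nonempty y S
  set x : G := (insert y S).sup' hne (fun s => s ⊔ s⁻¹)
  have hle : ∀ s ∈ insert y S, s ⊔ s⁻¹ ≤ x := fun s hs =>
    Finset.le_sup' (fun s : G => s ⊔ s⁻¹) hs
  have hx1 : 1 < x := by
    refine lt_of_lt_of_le ?_ (hle y (Finset.mem_insert_self y S))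
    rcases hy.lt_or_gt with h | h
    · exact lt_sup_of_lt_right (one_lt_inv'.2 h)
    · exact lt_sup_of_lt_left h
  refine ⟨x, hx1, fun g => ?_⟩
  suffices H : ∃ n : ℕ, g ≤ x ^ n ∧ g⁻¹ ≤ x ^ n from H.imp fun _ => And.left
  have hg : g ∈ Subgroup.closure (S : Set G) := hS ▸ Subgroup.mem_top g
  induction hg using Subgroup.closure_induction with
  | mem s hs =>
    have := hle s (Finset.mem_insert_of_mem hs)
    exact ⟨1, by simpa using this⟩
  | one => exact ⟨0, by simp⟩
  | mul a b _ _ iha ihb =>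
    obtain ⟨m, hm, hm'⟩ := iha
    obtain ⟨n, hn, hn'⟩ := ihb
    refine ⟨m + n, ?_, ?_⟩
    · rw [pow_add]; exact mul_le_mul' hm hn
    · rw [mul_inv_rev, add_comm, pow_add]; exact mul_le_mul' hn' hm'
  | inv a _ iha =>
    obtain ⟨n, hn, hn'⟩ := iha
    exact ⟨n, hn', by rwa [inv_inv]⟩

theorem exists_zpow_le_lt_zpow_add_one {x : G} (hx : 1 < x) (hcof : ∀ g : G, ∃ n : ℕ, g ≤ x ^ n)
    (g : G) : ∃ n : ℤ, x ^ n ≤ g ∧ g < x ^ (n + 1) := by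
  obtain ⟨m, hm⟩ := hcof g
  obtain ⟨k, hk⟩ := hcof g⁻¹
  obtain ⟨n, hn, hmax⟩ := Int.exists_greatest_of_bdd (P := fun n : ℤ => x ^ n ≤ g)
    ⟨m, fun z hz => (zpow_strictMono_of_one_lt hx).le_iff_le.1
      (hz.trans (hm.trans_eq (zpow_natCast x m).symm))⟩
    ⟨-k, by rw [zpow_neg, zpow_natCast]; exact inv_le_of_inv_le' hk⟩
  refine ⟨n, hn, lt_of_not_ge fun h => ?_⟩
  have := hmax _ h
  lia

/-- An integer-valued function on an ordered group satisfying the inequalities of a floor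
function homogenizes to a group homomorphism to `ℝ`. -/
theorem exists_monoidHom_tendsto_of_floor (f : G → ℤ) (hmono : Monotone f)
    (hlower : ∀ a b, f a + f b ≤ f (a * b)) (hupper : ∀ a b, f (a * b) ≤ f a + f b + 1) :
    ∃ φ : G →* Multiplicative ℝ, ∀ g : G,
      Tendsto (fun n : ℕ => (f (g ^ n) : ℝ) / n) atTop (𝓝 (φ g).toAdd) := by
  have hlim (g : G) : ∃ l : ℝ, Tendsto (fun n : ℕ => (f (g ^ n) : ℝ) / n) atTop (𝓝 l) := by
    have hsub : Subadditive fun n : ℕ => -(f (g ^ n) : ℝ) := fun m n => by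
      have := hlower (g ^ m) (g ^ n)
      rw [← pow_add] at this
      have : (f (g ^ m) : ℝ) + f (g ^ n) ≤ f (g ^ (m + n)) := by exact_mod_cast this
      linarith
    have hbound (n : ℕ) : f (g ^ n) ≤ n * (f g + 1) + f 1 := by
      induction n with
      | zero => simp
      | succ n ih =>
        have := hupper (g ^ n) g
        rw [pow_succ]
        push_cast
        linarith
    have hf1 : f 1 ≤ 0 := by
      have := hlower 1 1
      rw [mul_one] at this
      lia
    have hbdd : BddBelow (Set.range fun n : ℕ => -(f (g ^ n) : ℝ) / n) := by
      refine ⟨min 0 (-(f g + 1 : ℝ)), ?_⟩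
      rintro _ ⟨n, rfl⟩
      rcases n.eq_zero_or_pos with rfl | hn
      · simp
      · refine (min_le_right _ _).trans ?_
        have hn' : (0 : ℝ) < n := by exact_mod_cast hn
        have : (f (g ^ n) : ℝ) ≤ n * (f g + 1) := by
          exact_mod_cast (hbound n).trans (by linarith)
        rw [le_div_iff₀ hn']
        linarith
    exact ⟨-hsub.lim, by simpa [neg_div] using (hsub.tendsto_lim hbdd).neg⟩
  choose φ hφ using hlim
  have hclose (a b : G) (k : ℕ) : |f ((a * b) ^ k) - (f (a ^ k) + f (b ^ k))| ≤ 1 := by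
    have h₁ := hlower (a ^ k) (b ^ k)
    have h₂ := hupper (a ^ k) (b ^ k)
    have h₃ := hlower (b ^ k) (a ^ k)
    have h₄ := hupper (b ^ k) (a ^ k)
    rw [abs_le]
    rcases le_total (a * b) (b * a) with h | h
    · have h₅ := hmono (pow_mul_pow_le_mul_pow_of_mul_le_mul h k)
      have h₆ := hmono (mul_pow_le_pow_mul_pow_of_mul_le_mul h k)
      constructor <;> linarith
    · have h₅ := hmono (pow_mul_pow_le_mul_pow_of_mul_le_mul (M := Gᵒᵈ) (a := a) (b := b) h k)
      have h₆ := hmono (mul_pow_le_pow_mul_pow_of_mul_le_mul (M := Gᵒᵈ) (a := a) (b := b) h k)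
      change f ((a * b) ^ k) ≤ f (a ^ k * b ^ k) at h₅
      change f (b ^ k * a ^ k) ≤ f ((a * b) ^ k) at h₆
      constructor <;> linarith
  have hadd (a b : G) : φ (a * b) = φ a + φ b := by
    have hzero : Tendsto (fun n : ℕ => (f ((a * b) ^ n) : ℝ) / n -
        ((f (a ^ n) : ℝ) / n + (f (b ^ n) : ℝ) / n)) atTop (𝓝 0) := by
      refine squeeze_zero_norm (fun n => ?_) tendsto_one_div_atTop_nhds_zero_nat
      rw [← add_div, ← sub_div, norm_div, RCLike.norm_natCast, Real.norm_eq_abs]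
      gcongr
      exact_mod_cast hclose a b n
    exact sub_eq_zero.1 <|
      tendsto_nhds_unique ((hφ (a * b)).sub ((hφ a).add (hφ b))) hzero
  exact ⟨MonoidHom.mk' (fun g => Multiplicative.ofAdd (φ g)) fun a b => by
    rw [hadd, ofAdd_add], hφ⟩

/-- If the powers of `x` are cofinal in an ordered group, then some homomorphism to `ℝ` sends
`x` to `1`. -/
theorem exists_monoidHom_apply_eq_ofAdd_one {x : G} (hx : 1 < x)
    (hcof : ∀ g : G, ∃ n : ℕ, g ≤ x ^ n) :
    ∃ φ : G →* Multiplicative ℝ, φ x = Multiplicative.ofAdd 1 := by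
  choose f hf hf' using exists_zpow_le_lt_zpow_add_one hx hcof
  have hlt {m n : ℤ} {g : G} (hm : x ^ m ≤ g) (hn : g < x ^ n) : m < n :=
    (zpow_strictMono_of_one_lt hx).lt_iff_lt.1 (hm.trans_lt hn)
  obtain ⟨φ, hφ⟩ := exists_monoidHom_tendsto_of_floor f
    (fun a b hab => Int.lt_add_one_iff.1 (hlt ((hf a).trans hab) (hf' b)))
    (fun a b => Int.lt_add_one_iff.1 <| hlt
      (by rw [zpow_add]; exact mul_le_mul' (hf a) (hf b)) (hf' (a * b)))
    (fun a b => by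
      have := hlt (n := f a + 1 + (f b + 1)) (hf (a * b))
        (by rw [zpow_add]; exact mul_lt_mul_of_lt_of_lt (hf' a) (hf' b))
      lia)
  refine ⟨φ, Multiplicative.toAdd.injective (tendsto_nhds_unique (hφ x) ?_)⟩
  have hfx (n : ℕ) : f (x ^ n) = n := by
    have h₁ := hlt (hf (x ^ n)) (n := n + 1)
      (by rw [← zpow_natCast]; exact zpow_strictMono_of_one_lt hx (lt_add_one _))
    have h₂ := hlt (m := n) (by rw [zpow_natCast]) (hf' (x ^ n))
    lia
  refine tendsto_const_nhds.congr' ?_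
  filter_upwards [eventually_ne_atTop 0] with n hn
  rw [hfx, Int.cast_natCast, div_self (by exact_mod_cast hn), toAdd_ofAdd]

end OrderedGroup

/-- Every non-trivial finitely generated bi-orderable group admits a
non-trivial group homomorphism to the additive group `ℝ` (viewed multiplicatively). -/
theorem stmt6 (G : Type*) [Group G] [Group.FG G] [Nontrivial G] (h : BiOrderable G) :
    ∃ φ : G →* Multiplicative ℝ, φ ≠ 1 := by
  obtain ⟨lo, hlo⟩ := h
  have : MulLeftMono G := ⟨fun g a b hab => (hlo g a b hab).1⟩
  have : MulRightMono G := ⟨fun g a b hab => (hlo g a b hab).2⟩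
  obtain ⟨x, hx, hcof⟩ := exists_one_lt_forall_exists_le_pow (G := G)
  obtain ⟨φ, hφ⟩ := exists_monoidHom_apply_eq_ofAdd_one hx hcof
  refine ⟨φ, fun h => one_ne_zero (α := ℝ) ?_⟩
  rw [h, MonoidHom.one_apply] at hφ
  exact (congrArg Multiplicative.toAdd hφ).symm
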